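/- For γ = (a,b;c,d) ∈ SL(2,ℤ) with c ≠ 0, define S(γ) = (a+d)/(12c) − sgn(c)·(1/4 + s(d,|c|)), and for c = 0 define S(γ) = b/(12d) + (sgn(d)−1)/4, where s is the Dedekind sum. Then 12·S(γ) ∈ ℤ for every γ ∈ SL(2,ℤ). -/

import Mathlib

open Classical

/-- The sawtooth function ((x)). -/
noncomputable def sawtooth (x : ℝ) : ℝ :=
  if ∃ m : ℤ, x = m then 0 else x - ⌊x⌋ - 1 / 2

/-- The Dedekind sum `s(h,k)`. -/
noncomputable def dedekindSum (h k : ℤ) : ℝ :=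
  ∑ m ∈ Finset.range k.toNat, sawtooth ((h : ℝ) * m / k) * sawtooth ((m : ℝ) / k)

/-- Dedekind's symbol `S(γ)` for `γ = (a,b;c,d) ∈ SL(2,ℤ)`. -/
noncomputable def dedekindSymbol (γ : Matrix (Fin 2) (Fin 2) ℤ) : ℝ :=
  if γ 1 0 = 0 then
    (γ 0 1 : ℝ) / (12 * γ 1 1) + (((γ 1 1).sign : ℝ) - 1) / 4
  else
    ((γ 0 0 : ℝ) + γ 1 1) / (12 * γ 1 0)
      - ((γ 1 0).sign : ℝ) * (1 / 4 + dedekindSum (γ 1 1) |γ 1 0|)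

theorem ds_sum_perm (d a : ℤ) (k : ℕ) (hk : 0 < k) (b : ℤ) (h : a * d - b * k = 1) (f : ℤ → ℤ) :
    ∑ m ∈ Finset.range k, f ((d * m) % k) = ∑ m ∈ Finset.range k, f m := by
  have hk' : (0 : ℤ) < k := by exact_mod_cast hk
  have maps : ∀ m ∈ Finset.range k, ((d * (m:ℤ)) % k).toNat ∈ Finset.range k := by
    intro m _
    have h1 := Int.emod_nonneg (d * (m:ℤ)) hk'.ne'
    have h2 := Int.emod_lt_of_pos (d * (m:ℤ)) hk'
    rw [Finset.mem_range]; omega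
  have inj : Set.InjOn (fun m : ℕ => ((d * (m:ℤ)) % k).toNat) (Finset.range k : Set ℕ) := by
    intro m hm n hn hmn
    simp only [Finset.coe_range, Set.mem_Iio] at hm hn
    have h1 := Int.emod_nonneg (d * (m:ℤ)) hk'.ne'
    have h2 := Int.emod_nonneg (d * (n:ℤ)) hk'.ne'
    have h3 : (d * (m:ℤ)) % k = (d * (n:ℤ)) % k := by
      simp only at hmn; omega
    have h4 : (k:ℤ) ∣ d * n - d * m := Int.ModEq.dvd h3
    have h5 : (k:ℤ) ∣ (n:ℤ) - m := by
      have : (n:ℤ) - m = a * (d * n - d * m) - k * (b * (n - m)) := by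
        linear_combination (-(n:ℤ) + m) * h
      rw [this]
      exact dvd_sub (h4.mul_left _) (dvd_mul_right _ _)
    have h6 : (m:ℤ) % k = n % k := (Int.modEq_iff_dvd.mpr h5)
    rw [Int.emod_eq_of_lt (by positivity) (by exact_mod_cast hm),
      Int.emod_eq_of_lt (by positivity) (by exact_mod_cast hn)] at h6
    exact_mod_cast h6
  refine Finset.sum_nbij (fun m : ℕ => ((d * (m:ℤ)) % k).toNat) maps inj
    (Finset.surjOn_of_injOn_of_card_le _ maps inj le_rfl) ?_
  intro m _
  have h1 := Int.emod_nonneg (d * (m:ℤ)) hk'.ne'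
  simp only [Int.toNat_of_nonneg h1]

theorem ds_sum_one (k : ℕ) : 2 * ∑ m ∈ Finset.range k, (m:ℤ) = k * (k - 1) := by
  induction k with
  | zero => simp
  | succ n ih => rw [Finset.sum_range_succ, mul_add, ih]; push_cast; ring

theorem ds_sum_two (k : ℕ) :
    6 * ∑ m ∈ Finset.range k, (m:ℤ) ^ 2 = k * (k - 1) * (2 * k - 1) := by
  induction k with
  | zero => simp
  | succ n ih => rw [Finset.sum_range_succ, mul_add, ih]; push_cast; ring

theorem ds_saw (n : ℤ) (k : ℕ) (hk : 0 < k) (h : ¬ (k:ℤ) ∣ n) :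
    sawtooth ((n:ℝ) / k) = ((n % k : ℤ) : ℝ) / k - 1 / 2 := by
  have hk' : (0 : ℤ) < k := by exact_mod_cast hk
  have hkr : (0 : ℝ) < k := by exact_mod_cast hk
  have hn : ¬ ∃ m : ℤ, (n:ℝ) / k = m := by
    rintro ⟨m, hm⟩
    rw [div_eq_iff hkr.ne'] at hm
    exact h ⟨m, by rw [mul_comm]; exact_mod_cast hm⟩
  have e : (n:ℝ) = k * ((n / k : ℤ) : ℝ) + ((n % k : ℤ) : ℝ) := by
    exact_mod_cast (Int.mul_ediv_add_emod n k).symm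
  have e1 : (0:ℝ) ≤ ((n % k : ℤ) : ℝ) := by exact_mod_cast Int.emod_nonneg n hk'.ne'
  have e2 : ((n % k : ℤ) : ℝ) < k := by exact_mod_cast Int.emod_lt_of_pos n hk'
  have fl : ⌊(n:ℝ) / k⌋ = n / k := by
    rw [Int.floor_eq_iff, le_div_iff₀ hkr, div_lt_iff₀ hkr]
    constructor <;> nlinarith
  rw [sawtooth, if_neg hn, fl]
  generalize ((n / k : ℤ) : ℝ) = q at *
  rw [e]; field_simp; ring

theorem ds_key (d a : ℤ) (k : ℕ) (hk : 0 < k) (b : ℤ) (h : a * d - b * k = 1) :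
    ∃ z : ℤ, 12 * dedekindSum d k = ((a:ℝ) + d) / k + z := by
  have hkr : (0 : ℝ) < k := by exact_mod_cast hk
  have hk' : (0 : ℤ) < k := by exact_mod_cast hk
  have nd : ∀ m ∈ Finset.range k, m ≠ 0 → ¬ (k:ℤ) ∣ (m:ℤ) := by
    intro m hm h0 hd
    rw [Finset.mem_range] at hm
    have := Nat.le_of_dvd (Nat.pos_of_ne_zero h0) (by exact_mod_cast hd)
    omega
  have nd2 : ∀ m ∈ Finset.range k, m ≠ 0 → ¬ (k:ℤ) ∣ d * (m:ℤ) := by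
    intro m hm h0 hd
    apply nd m hm h0
    have : (m:ℤ) = a * (d * m) - k * (b * m) := by linear_combination (-(m:ℤ)) * h
    rw [this]
    exact dvd_sub (hd.mul_left _) (dvd_mul_right _ _)
  have s1 : dedekindSum d k = ∑ m ∈ Finset.range k,
      (((((d * m) % k : ℤ) : ℝ) / k - 1 / 2) * ((m:ℝ) / k - 1 / 2) - if m = 0 then 1/4 else 0) := by
    rw [dedekindSum, Int.toNat_natCast]
    refine Finset.sum_congr rfl fun m hm => ?_
    by_cases h0 : m = 0
    · subst h0
      have : sawtooth 0 = 0 := by rw [sawtooth, if_pos ⟨0, by simp⟩]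
      simp [this]; norm_num
    · rw [if_neg h0, sub_zero]
      have A := ds_saw (d * m) k hk (nd2 m hm h0)
      have B := ds_saw m k hk (nd m hm h0)
      rw [Int.emod_eq_of_lt (by positivity) (by exact_mod_cast Finset.mem_range.mp hm)] at B
      push_cast at A B ⊢
      rw [A, B]
  set R := ∑ m ∈ Finset.range k, ((d * m) % k : ℤ) * (m:ℤ) with hR
  set M := ∑ m ∈ Finset.range k, (m:ℤ) with hM
  set M2 := ∑ m ∈ Finset.range k, (m:ℤ)^2 with hM2
  set Q := ∑ m ∈ Finset.range k, (m:ℤ) * (d * m / k) with hQ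
  set Q2 := ∑ m ∈ Finset.range k, (d * m / k : ℤ)^2 with hQ2
  have p1 : ∑ m ∈ Finset.range k, ((d * m) % k : ℤ) = M := ds_sum_perm d a k hk b h (fun x => x)
  have p2 : ∑ m ∈ Finset.range k, ((d * m) % k : ℤ)^2 = M2 :=
    ds_sum_perm d a k hk b h (fun x => x^2)
  have m1 := ds_sum_one k
  have m2 := ds_sum_two k
  rw [← hM] at m1
  rw [← hM2] at m2
  have r1 : R = d * M2 - k * Q := by
    rw [hR, hM2, hQ, Finset.mul_sum, Finset.mul_sum, ← Finset.sum_sub_distrib]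
    refine Finset.sum_congr rfl fun m _ => ?_
    rw [Int.emod_def]; ring
  have r2 : M2 = d^2 * M2 - 2 * d * k * Q + k^2 * Q2 := by
    conv_lhs => rw [← p2]
    rw [hM2, hQ, hQ2, Finset.mul_sum, Finset.mul_sum, Finset.mul_sum, ← Finset.sum_sub_distrib,
      ← Finset.sum_add_distrib]
    refine Finset.sum_congr rfl fun m _ => ?_
    rw [Int.emod_def]; ring
  have s2 : dedekindSum d k = (R:ℝ) / k^2 - (M:ℝ) / k + k / 4 - 1 / 4 := by
    have t1 : (R:ℝ) = ∑ m ∈ Finset.range k, (((d * m) % k : ℤ) : ℝ) * (m:ℝ) := by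
      rw [hR]; push_cast; rfl
    have t2 : (M:ℝ) = ∑ m ∈ Finset.range k, (m:ℝ) := by
      rw [hM]; push_cast; rfl
    have t3 : (M:ℝ) = ∑ m ∈ Finset.range k, (((d * m) % k : ℤ) : ℝ) := by
      rw [← p1]; push_cast; rfl
    have t4 : ∑ m ∈ Finset.range k, (if m = 0 then (1/4:ℝ) else 0) = 1/4 := by
      rw [Finset.sum_ite_eq' ]; simp [hk]
    have t5 : (k:ℝ) / 4 = ∑ m ∈ Finset.range k, (1/4:ℝ) := by simp; ring
    have t6 : (M:ℝ) / k = (M:ℝ) / k / 2 + (M:ℝ) / k / 2 := by ring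
    rw [s1, Finset.sum_sub_distrib, t4, t6]
    congr 1
    nth_rewrite 1 [t2]
    rw [t3, t1, t5]
    simp only [Finset.sum_div]
    rw [← Finset.sum_add_distrib, ← Finset.sum_sub_distrib, ← Finset.sum_add_distrib]
    refine Finset.sum_congr rfl fun m _ => ?_
    field_simp; ring
  have q1 : 12 * d * Q = (d^2 - 1) * (k - 1) * (2 * k - 1) + 6 * k * Q2 := by
    apply mul_left_cancel₀ hk'.ne'
    linear_combination 6 * r2 + (d^2 - 1) * m2
  have q2 : ∃ w : ℤ, 12 * Q = d - a + k * w := by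
    refine ⟨a * ((d^2-1) * (2*k-3) + 6 * Q2) + d * b - 12 * b * Q, ?_⟩
    linear_combination a * q1 + (d - 12 * Q) * h
  obtain ⟨w, hw⟩ := q2
  refine ⟨d * (4 * k - 6) - w - 3 * (k - 1), ?_⟩
  have f1 : (2:ℝ) * M = k * (k - 1) := by exact_mod_cast m1
  have f2 : (6:ℝ) * M2 = k * (k - 1) * (2 * k - 1) := by exact_mod_cast m2
  have f3 : (R:ℝ) = d * M2 - k * Q := by exact_mod_cast r1
  have f4 : (12:ℝ) * Q = d - a + k * w := by exact_mod_cast hw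
  rw [s2, f3]
  push_cast
  field_simp
  linear_combination 4 * ((-6 * (k:ℝ)) * f1 + 2 * d * f2 - (k:ℝ) * f4)

theorem twelve_mul_dedekindSymbol_int (γ : Matrix (Fin 2) (Fin 2) ℤ)
    (hγ : γ.det = 1) :
    ∃ m : ℤ, 12 * dedekindSymbol γ = (m : ℝ) := by
  rw [Matrix.det_fin_two] at hγ
  rw [dedekindSymbol]
  generalize γ 0 0 = a at *
  generalize γ 0 1 = b at *
  generalize γ 1 0 = c at *
  generalize γ 1 1 = d at *
  split_ifs with hc
  · subst hc
    have : d = 1 ∨ d = -1 := by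
      apply Int.isUnit_iff.mp
      exact IsUnit.of_mul_eq_one a (by linarith)
    rcases this with rfl | rfl
    · exact ⟨b, by norm_num; ring⟩
    · exact ⟨-b - 6, by norm_num; ring⟩
  · rcases lt_or_gt_of_ne hc with h | h
    · obtain ⟨k, rfl⟩ : ∃ k : ℕ, c = -k := ⟨c.natAbs, by omega⟩
      have hk : 0 < k := by omega
      obtain ⟨z, hz⟩ := ds_key d a k hk (-b) (by linarith)
      refine ⟨3 + z, ?_⟩
      rw [Int.sign_eq_neg_one_of_neg h, abs_neg, Nat.abs_cast]
      have hkr : (k:ℝ) ≠ 0 := by exact_mod_cast hk.ne'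
      push_cast
      have : ((a:ℝ) + d) / (12 * -k) = -(((a:ℝ) + d) / k) / 12 := by field_simp
      rw [this]
      linear_combination hz
    · obtain ⟨k, rfl⟩ : ∃ k : ℕ, c = k := ⟨c.natAbs, by omega⟩
      have hk : 0 < k := by omega
      obtain ⟨z, hz⟩ := ds_key d a k hk b (by linarith)
      refine ⟨-3 - z, ?_⟩
      rw [Int.sign_eq_one_of_pos h, Nat.abs_cast]
      have hkr : (k:ℝ) ≠ 0 := by exact_mod_cast hk.ne'
      push_cast
      have : ((a:ℝ) + d) / (12 * k) = (((a:ℝ) + d) / k) / 12 := by field_simp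
      rw [this]
      linear_combination -hz
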